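/- arXiv:2305.08188 — 3 statements merged into one kernel-verified Lean document; each statement's English description precedes it below -/
import Mathlib

section
/- The group of all ℤ-linear automorphisms θ of the lattice Λ satisfying c(θ(t)) = c(t) for all t ∈ Λ has exactly 144 elements. -/
/-- A BZ triangle datum: coordinates `(y₁,y₂,y₃,z₁,z₂,z₃,z₄,z₅,z₆)` indexed `0,…,8`.
`IsBZ T` says all coordinates are nonnegative and `z₁−z₄ = z₅−z₂ = z₃−z₆`. -/
def IsBZ (T : Fin 9 → ℤ) : Prop :=
  (∀ i, 0 ≤ T i) ∧ T 3 - T 6 = T 7 - T 4 ∧ T 7 - T 4 = T 5 - T 8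

/-- projection to `(ℓ₁,ℓ₂,m₁,m₂,n₁,n₂)`. -/
def pr (T : Fin 9 → ℤ) : Fin 6 → ℤ :=
  ![T 1 + T 6, T 2 + T 7, T 2 + T 8, T 0 + T 3, T 0 + T 4, T 1 + T 5]

/-- the SU(3) triple multiplicity: number of BZ triangles lying over `t`. -/
noncomputable def c (t : Fin 6 → ℤ) : ℕ :=
  Nat.card {T : Fin 9 → ℤ // IsBZ T ∧ pr T = t}

/-- The lattice Λ of points `(ℓ₁,ℓ₂,m₁,m₂,n₁,n₂) ∈ ℤ⁶` with
`ℓ₁+m₁+n₁ ≡ ℓ₂+m₂+n₂ (mod 3)`, as a ℤ-submodule of `ℤ⁶`. -/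
def latticeTM : Submodule ℤ (Fin 6 → ℤ) where
  carrier := {t | (3 : ℤ) ∣ (t 0 + t 2 + t 4 - t 1 - t 3 - t 5)}
  add_mem' := by
    rintro a b ⟨k, hk⟩ ⟨l, hl⟩
    exact ⟨k + l, by simp only [Pi.add_apply]; linarith⟩
  zero_mem' := ⟨0, by simp⟩
  smul_mem' := by
    rintro m a ⟨k, hk⟩
    refine ⟨m * k, ?_⟩
    simp only [Pi.smul_apply, smul_eq_mul]
    linear_combination m * hk

abbrev GI := (Bool × Fin 3) ⊕ Fin 2

/-- the BZ datum attached to integer weights on the eight generators -/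
def lft (x : GI → ℤ) : Fin 9 → ℤ :=
  ![x (.inl (false, 0)), x (.inl (false, 1)), x (.inl (false, 2)),
    x (.inl (true, 0)) + x (.inr 0), x (.inl (true, 1)) + x (.inr 1),
    x (.inl (true, 2)) + x (.inr 0), x (.inl (true, 0)) + x (.inr 1),
    x (.inl (true, 1)) + x (.inr 0), x (.inl (true, 2)) + x (.inr 1)]

lemma pr_lft (x : GI → ℤ) : pr (lft x) =
  ![x (.inl (false, 1)) + (x (.inl (true, 0)) + x (.inr 1)),
    x (.inl (false, 2)) + (x (.inl (true, 1)) + x (.inr 0)),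
    x (.inl (false, 2)) + (x (.inl (true, 2)) + x (.inr 1)),
    x (.inl (false, 0)) + (x (.inl (true, 0)) + x (.inr 0)),
    x (.inl (false, 0)) + (x (.inl (true, 1)) + x (.inr 1)),
    x (.inl (false, 1)) + (x (.inl (true, 2)) + x (.inr 0))] := rfl

lemma vec6_eq (a b : Fin 6 → ℤ) : a = b ↔
    a 0 = b 0 ∧ a 1 = b 1 ∧ a 2 = b 2 ∧ a 3 = b 3 ∧ a 4 = b 4 ∧ a 5 = b 5 := by
  constructor
  · rintro rfl; simp
  · rintro ⟨h0, h1, h2, h3, h4, h5⟩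
    funext i; fin_cases i <;> assumption

def phi : (GI → ℤ) →ₗ[ℤ] latticeTM where
  toFun x := ⟨pr (lft x), by
    show (3 : ℤ) ∣ _
    rw [pr_lft]
    simp
    exact ⟨x (.inr 1) - x (.inr 0), by ring⟩⟩
  map_add' x y := by
    apply Subtype.ext
    show pr (lft (x + y)) = pr (lft x) + pr (lft y)
    rw [vec6_eq]
    simp only [pr_lft]
    simp
    refine ⟨?_, ?_, ?_, ?_, ?_, ?_⟩ <;> ring
  map_smul' k x := by
    apply Subtype.ext
    show pr (lft (k • x)) = k • pr (lft x)
    rw [vec6_eq]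
    simp only [pr_lft]
    simp
    refine ⟨?_, ?_, ?_, ?_, ?_, ?_⟩ <;> ring

lemma phi_coe (x : GI → ℤ) : ((phi x : latticeTM) : Fin 6 → ℤ) = pr (lft x) := rfl

lemma phi_eq_iff (x : GI → ℤ) (t : latticeTM) : phi x = t ↔
    x (.inl (false, 1)) + (x (.inl (true, 0)) + x (.inr 1)) = t.1 0 ∧
    x (.inl (false, 2)) + (x (.inl (true, 1)) + x (.inr 0)) = t.1 1 ∧
    x (.inl (false, 2)) + (x (.inl (true, 2)) + x (.inr 1)) = t.1 2 ∧
    x (.inl (false, 0)) + (x (.inl (true, 0)) + x (.inr 0)) = t.1 3 ∧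
    x (.inl (false, 0)) + (x (.inl (true, 1)) + x (.inr 1)) = t.1 4 ∧
    x (.inl (false, 1)) + (x (.inl (true, 2)) + x (.inr 0)) = t.1 5 := by
  rw [Subtype.ext_iff, phi_coe, vec6_eq, pr_lft]
  rfl

def mkx (y0 y1 y2 a0 a1 a2 b0 b1 : ℤ) : GI → ℤ
  | .inl (false, i) => ![y0, y1, y2] i
  | .inl (true, i) => ![a0, a1, a2] i
  | .inr q => ![b0, b1] q

lemma phi_surj : Function.Surjective phi := by
  rintro t
  obtain ⟨k, hk⟩ : (3 : ℤ) ∣ _ := t.2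
  refine ⟨mkx 0 (t.1 0 - t.1 3 - k) (t.1 1 - t.1 4 + k) (t.1 3 + k) (t.1 4)
    (t.1 2 - (t.1 1 - t.1 4 + k)) (-k) 0, ?_⟩
  rw [phi_eq_iff]
  simp [mkx]
  refine ⟨?_, ?_⟩ <;> linarith

def form (i j : Fin 3) (q : Fin 2) (x : GI → ℤ) : ℤ :=
  x (.inl (false, i)) + x (.inl (true, j)) + x (.inr q)

lemma mem_ker_phi (x : GI → ℤ) : x ∈ LinearMap.ker phi ↔ ∀ i j q, form i j q x = 0 := by
  rw [LinearMap.mem_ker, phi_eq_iff]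
  simp only [form, Fin.forall_fin_succ, IsEmpty.forall_iff, and_true]
  simp
  constructor
  · intro h
    refine ⟨⟨⟨?_, ?_⟩, ⟨?_, ?_⟩, ?_, ?_⟩, ⟨⟨?_, ?_⟩, ⟨?_, ?_⟩, ?_, ?_⟩, ⟨?_, ?_⟩, ⟨?_, ?_⟩, ?_, ?_⟩ <;> omega
  · intro h
    refine ⟨?_, ?_, ?_, ?_, ?_, ?_⟩ <;> omega

def mn (x : GI → ℤ) : ℤ :=
  min (x (.inl (false, 0))) (min (x (.inl (false, 1))) (x (.inl (false, 2)))) +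
  min (x (.inl (true, 0))) (min (x (.inl (true, 1))) (x (.inl (true, 2)))) +
  min (x (.inr 0)) (x (.inr 1))

lemma le_mn (x : GI → ℤ) (k : ℤ) : k ≤ mn x ↔ ∀ i j q, k ≤ form i j q x := by
  simp only [form, mn, Fin.forall_fin_succ, IsEmpty.forall_iff, and_true]
  simp
  constructor
  · intro h
    refine ⟨⟨⟨?_, ?_⟩, ⟨?_, ?_⟩, ?_, ?_⟩, ⟨⟨?_, ?_⟩, ⟨?_, ?_⟩, ?_, ?_⟩, ⟨?_, ?_⟩, ⟨?_, ?_⟩, ?_, ?_⟩ <;> omega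
  · intro h
    omega

lemma vec9_eq (a b : Fin 9 → ℤ) : a = b ↔
    a 0 = b 0 ∧ a 1 = b 1 ∧ a 2 = b 2 ∧ a 3 = b 3 ∧ a 4 = b 4 ∧ a 5 = b 5 ∧
    a 6 = b 6 ∧ a 7 = b 7 ∧ a 8 = b 8 := by
  constructor
  · rintro rfl; simp
  · rintro ⟨h0, h1, h2, h3, h4, h5, h6, h7, h8⟩
    funext i; fin_cases i <;> assumption

lemma nonneg9 (a : Fin 9 → ℤ) : (∀ i, 0 ≤ a i) ↔
    0 ≤ a 0 ∧ 0 ≤ a 1 ∧ 0 ≤ a 2 ∧ 0 ≤ a 3 ∧ 0 ≤ a 4 ∧ 0 ≤ a 5 ∧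
    0 ≤ a 6 ∧ 0 ≤ a 7 ∧ 0 ≤ a 8 := by
  constructor
  · intro h; simp [h]
  · rintro ⟨h0, h1, h2, h3, h4, h5, h6, h7, h8⟩
    intro i; fin_cases i <;> assumption

lemma pr_eq (T : Fin 9 → ℤ) (t : Fin 6 → ℤ) : pr T = t ↔
    T 1 + T 6 = t 0 ∧ T 2 + T 7 = t 1 ∧ T 2 + T 8 = t 2 ∧ T 0 + T 3 = t 3 ∧
    T 0 + T 4 = t 4 ∧ T 1 + T 5 = t 5 := by
  rw [vec6_eq]; rfl

def shiftT (x : GI → ℤ) (k : ℤ) : Fin 9 → ℤ :=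
  ![lft x 0 + k, lft x 1 + k, lft x 2 + k, lft x 3 - k, lft x 4 - k, lft x 5 - k,
    lft x 6 - k, lft x 7 - k, lft x 8 - k]

lemma c_phi (x : GI → ℤ) : c (phi x : latticeTM) = (mn x + 1).toNat := by
  have hb : Function.Bijective (fun k : Set.Icc
      (-(min (x (.inl (false, 0))) (min (x (.inl (false, 1))) (x (.inl (false, 2))))))
      (min (x (.inl (true, 0))) (min (x (.inl (true, 1))) (x (.inl (true, 2)))) +
        min (x (.inr 0)) (x (.inr 1))) =>
      (⟨shiftT x k.1, by
        obtain ⟨k, h1, h2⟩ := k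
        refine ⟨⟨?_, ?_, ?_⟩, ?_⟩
        · rw [nonneg9]
          simp [shiftT, lft]
          refine ⟨?_, ?_, ?_, ?_, ?_, ?_, ?_, ?_, ?_⟩ <;> omega
        · simp [shiftT, lft]
        · simp [shiftT, lft]
        · rw [pr_eq, phi_coe, pr_lft]
          simp [shiftT, lft]⟩ :
        {T : Fin 9 → ℤ // IsBZ T ∧ pr T = ((phi x : latticeTM) : Fin 6 → ℤ)})) := by
    constructor
    · rintro ⟨k, hk⟩ ⟨l, hl⟩ h
      have := congrFun (congrArg Subtype.val h) 0
      simp [shiftT] at this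
      exact Subtype.ext this
    · rintro ⟨T, ⟨hT, hT1, hT2⟩, hT3⟩
      rw [nonneg9] at hT
      have hT4 := hT3
      rw [pr_eq, phi_coe, pr_lft] at hT4
      simp at hT4
      refine ⟨⟨T 0 - x (.inl (false, 0)), ?_, ?_⟩, ?_⟩
      · omega
      · omega
      · apply Subtype.ext
        show shiftT _ _ = T
        rw [vec9_eq]
        simp [shiftT, lft]
        refine ⟨?_, ?_, ?_, ?_, ?_, ?_, ?_, ?_⟩ <;> omega
  unfold c
  rw [← Nat.card_eq_of_bijective _ hb, Nat.card_coe_set_eq, ← Finset.coe_Icc, Set.ncard_coe_finset,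
    Int.card_Icc]
  congr 1
  unfold mn
  ring

lemma c_pos_iff (t : latticeTM) : 0 < c t ↔ ∃ T, IsBZ T ∧ pr T = t := by
  constructor
  · intro h
    obtain ⟨T⟩ := (Nat.card_pos_iff.mp h).1
    exact ⟨T.1, T.2⟩
  · rintro ⟨T, ⟨hT, hT1, hT2⟩, hT3⟩
    obtain ⟨x, rfl⟩ := phi_surj t
    rw [nonneg9] at hT
    rw [pr_eq, phi_coe, pr_lft] at hT3
    simp at hT3
    rw [c_phi]
    have : 0 ≤ mn x := by
      rw [le_mn]
      simp only [form, Fin.forall_fin_succ, IsEmpty.forall_iff, and_true]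
      simp
      refine ⟨⟨⟨?_, ?_⟩, ⟨?_, ?_⟩, ?_, ?_⟩, ⟨⟨?_, ?_⟩, ⟨?_, ?_⟩, ?_, ?_⟩, ⟨?_, ?_⟩, ⟨?_, ?_⟩, ?_, ?_⟩ <;> omega
    omega

def gen (k : GI) : latticeTM := phi (Pi.single k 1)

def IrrC (t : latticeTM) : Prop :=
  0 < c t ∧ t ≠ 0 ∧ ∀ u v : latticeTM, 0 < c u → 0 < c v → u + v = t → u = 0 ∨ v = 0

lemma irr_map (θ : latticeTM ≃ₗ[ℤ] latticeTM)
    (h : ∀ t : latticeTM, c ((θ t : Fin 6 → ℤ)) = c (t : Fin 6 → ℤ)) (t : latticeTM)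
    (ht : IrrC t) : IrrC (θ t) := by
  obtain ⟨h1, h2, h3⟩ := ht
  refine ⟨by rwa [h], by simpa using h2, ?_⟩
  intro u v hu hv huv
  have := h3 (θ.symm u) (θ.symm v) (by rw [← h]; simpa using hu) (by rw [← h]; simpa using hv)
    (by rw [← map_add, huv]; simp)
  simpa using this

lemma gi_cases (P : GI → Prop) (h0 : P (.inl (false, 0))) (h1 : P (.inl (false, 1)))
    (h2 : P (.inl (false, 2))) (h3 : P (.inl (true, 0))) (h4 : P (.inl (true, 1)))
    (h5 : P (.inl (true, 2))) (h6 : P (.inr 0)) (h7 : P (.inr 1)) (k : GI) : P k := by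
  rcases k with ⟨b, i⟩ | q
  · cases b <;> fin_cases i <;> assumption
  · fin_cases q <;> assumption

lemma gen_coe (k : GI) : ((gen k : latticeTM) : Fin 6 → ℤ) = pr (lft (Pi.single k 1)) := rfl

lemma gen_ne_zero (k : GI) : gen k ≠ 0 := by
  intro h
  have := congrArg Subtype.val h
  rw [gen_coe] at this
  revert this
  revert k
  decide

lemma gen_injective : Function.Injective gen := by
  intro k l h
  have := congrArg Subtype.val h
  rw [gen_coe, gen_coe] at this
  clear h
  revert this
  revert k l
  decide

set_option maxHeartbeats 2000000 in
lemma irr_gen (k : GI) : IrrC (gen k) := by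
  refine ⟨?_, gen_ne_zero k, ?_⟩
  · unfold gen
    rw [c_phi]
    revert k
    decide
  · intro u v hu hv huv
    obtain ⟨T, ⟨hT, hT1, hT2⟩, hT3⟩ := (c_pos_iff u).1 hu
    obtain ⟨S, ⟨hS, hS1, hS2⟩, hS3⟩ := (c_pos_iff v).1 hv
    have huv' := congrArg Subtype.val huv
    rw [gen_coe] at huv'
    simp only [Submodule.coe_add] at huv'
    rw [Subtype.ext_iff, Subtype.ext_iff]
    rw [← hT3, ← hS3] at *
    clear hu hv huv hT3 hS3
    rw [nonneg9] at hT hS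
    simp only [Submodule.coe_zero, vec6_eq, Pi.add_apply] at *
    simp only [pr_lft] at huv'
    revert huv'
    revert k
    have fin : ∀ j : Fin 9, (T j = 0 → T 1 + T 6 = 0 ∧ T 2 + T 7 = 0 ∧ T 2 + T 8 = 0 ∧
        T 0 + T 3 = 0 ∧ T 0 + T 4 = 0 ∧ T 1 + T 5 = 0) → (S j = 0 → S 1 + S 6 = 0 ∧
        S 2 + S 7 = 0 ∧ S 2 + S 8 = 0 ∧ S 0 + S 3 = 0 ∧ S 0 + S 4 = 0 ∧ S 1 + S 5 = 0) →
        (T j = 0 ∨ S j = 0) → ((T 1 + T 6 = 0 ∧ T 2 + T 7 = 0 ∧ T 2 + T 8 = 0 ∧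
        T 0 + T 3 = 0 ∧ T 0 + T 4 = 0 ∧ T 1 + T 5 = 0) ∨ (S 1 + S 6 = 0 ∧
        S 2 + S 7 = 0 ∧ S 2 + S 8 = 0 ∧ S 0 + S 3 = 0 ∧ S 0 + S 4 = 0 ∧ S 1 + S 5 = 0)) :=
      fun j h1 h2 h3 => h3.imp h1 h2
    refine gi_cases _ ?_ ?_ ?_ ?_ ?_ ?_ ?_ ?_
    · intro h
      simp [pr] at h ⊢
      have a0 : T 0 + S 0 = 1 := by omega
      have a1 : T 1 + S 1 = 0 := by omega
      have a2 : T 2 + S 2 = 0 := by omega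
      have a3 : T 3 + S 3 = 0 := by omega
      have a4 : T 4 + S 4 = 0 := by omega
      have a5 : T 5 + S 5 = 0 := by omega
      have a6 : T 6 + S 6 = 0 := by omega
      have a7 : T 7 + S 7 = 0 := by omega
      have a8 : T 8 + S 8 = 0 := by omega
      clear h
      refine fin 0 (fun h => ?_) (fun h => ?_) (by omega) <;>
        refine ⟨?_, ?_, ?_, ?_, ?_, ?_⟩ <;> omega
    · intro h
      simp [pr] at h ⊢
      have a0 : T 0 + S 0 = 0 := by omega
      have a1 : T 1 + S 1 = 1 := by omega
      have a2 : T 2 + S 2 = 0 := by omega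
      have a3 : T 3 + S 3 = 0 := by omega
      have a4 : T 4 + S 4 = 0 := by omega
      have a5 : T 5 + S 5 = 0 := by omega
      have a6 : T 6 + S 6 = 0 := by omega
      have a7 : T 7 + S 7 = 0 := by omega
      have a8 : T 8 + S 8 = 0 := by omega
      clear h
      refine fin 1 (fun h => ?_) (fun h => ?_) (by omega) <;>
        refine ⟨?_, ?_, ?_, ?_, ?_, ?_⟩ <;> omega
    · intro h
      simp [pr] at h ⊢
      have a0 : T 0 + S 0 = 0 := by omega
      have a1 : T 1 + S 1 = 0 := by omega
      have a2 : T 2 + S 2 = 1 := by omega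
      have a3 : T 3 + S 3 = 0 := by omega
      have a4 : T 4 + S 4 = 0 := by omega
      have a5 : T 5 + S 5 = 0 := by omega
      have a6 : T 6 + S 6 = 0 := by omega
      have a7 : T 7 + S 7 = 0 := by omega
      have a8 : T 8 + S 8 = 0 := by omega
      clear h
      refine fin 2 (fun h => ?_) (fun h => ?_) (by omega) <;>
        refine ⟨?_, ?_, ?_, ?_, ?_, ?_⟩ <;> omega
    · intro h
      simp [pr] at h ⊢
      have a0 : T 0 + S 0 = 0 := by omega
      have a1 : T 1 + S 1 = 0 := by omega
      have a2 : T 2 + S 2 = 0 := by omega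
      have a3 : T 3 + S 3 = 1 := by omega
      have a4 : T 4 + S 4 = 0 := by omega
      have a5 : T 5 + S 5 = 0 := by omega
      have a6 : T 6 + S 6 = 1 := by omega
      have a7 : T 7 + S 7 = 0 := by omega
      have a8 : T 8 + S 8 = 0 := by omega
      clear h
      refine fin 3 (fun h => ?_) (fun h => ?_) (by omega) <;>
        refine ⟨?_, ?_, ?_, ?_, ?_, ?_⟩ <;> omega
    · intro h
      simp [pr] at h ⊢
      have a0 : T 0 + S 0 = 0 := by omega
      have a1 : T 1 + S 1 = 0 := by omega
      have a2 : T 2 + S 2 = 0 := by omega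
      have a3 : T 3 + S 3 = 0 := by omega
      have a4 : T 4 + S 4 = 1 := by omega
      have a5 : T 5 + S 5 = 0 := by omega
      have a6 : T 6 + S 6 = 0 := by omega
      have a7 : T 7 + S 7 = 1 := by omega
      have a8 : T 8 + S 8 = 0 := by omega
      clear h
      refine fin 4 (fun h => ?_) (fun h => ?_) (by omega) <;>
        refine ⟨?_, ?_, ?_, ?_, ?_, ?_⟩ <;> omega
    · intro h
      simp [pr] at h ⊢
      have a0 : T 0 + S 0 = 0 := by omega
      have a1 : T 1 + S 1 = 0 := by omega
      have a2 : T 2 + S 2 = 0 := by omega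
      have a3 : T 3 + S 3 = 0 := by omega
      have a4 : T 4 + S 4 = 0 := by omega
      have a5 : T 5 + S 5 = 1 := by omega
      have a6 : T 6 + S 6 = 0 := by omega
      have a7 : T 7 + S 7 = 0 := by omega
      have a8 : T 8 + S 8 = 1 := by omega
      clear h
      refine fin 5 (fun h => ?_) (fun h => ?_) (by omega) <;>
        refine ⟨?_, ?_, ?_, ?_, ?_, ?_⟩ <;> omega
    · intro h
      simp [pr] at h ⊢
      have a0 : T 0 + S 0 = 0 := by omega
      have a1 : T 1 + S 1 = 0 := by omega
      have a2 : T 2 + S 2 = 0 := by omega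
      have a3 : T 3 + S 3 = 1 := by omega
      have a4 : T 4 + S 4 = 0 := by omega
      have a5 : T 5 + S 5 = 1 := by omega
      have a6 : T 6 + S 6 = 0 := by omega
      have a7 : T 7 + S 7 = 1 := by omega
      have a8 : T 8 + S 8 = 0 := by omega
      clear h
      refine fin 3 (fun h => ?_) (fun h => ?_) (by omega) <;>
        refine ⟨?_, ?_, ?_, ?_, ?_, ?_⟩ <;> omega
    · intro h
      simp [pr] at h ⊢
      have a0 : T 0 + S 0 = 0 := by omega
      have a1 : T 1 + S 1 = 0 := by omega
      have a2 : T 2 + S 2 = 0 := by omega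
      have a3 : T 3 + S 3 = 0 := by omega
      have a4 : T 4 + S 4 = 1 := by omega
      have a5 : T 5 + S 5 = 0 := by omega
      have a6 : T 6 + S 6 = 1 := by omega
      have a7 : T 7 + S 7 = 0 := by omega
      have a8 : T 8 + S 8 = 1 := by omega
      clear h
      refine fin 4 (fun h => ?_) (fun h => ?_) (by omega) <;>
        refine ⟨?_, ?_, ?_, ?_, ?_, ?_⟩ <;> omega

lemma gen_of_irr (t : latticeTM) (ht : IrrC t) : ∃ k, gen k = t := by
  obtain ⟨h1, h2, h3⟩ := ht
  obtain ⟨T, ⟨hT, hT1, hT2⟩, hT3⟩ := (c_pos_iff t).1 h1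
  by_contra hne
  have key : ∀ k, ¬ ∃ T', IsBZ T' ∧ lft (Pi.single k 1) + T' = T := by
    rintro k ⟨T', hT', hs⟩
    have hp : pr T' = ((t - gen k : latticeTM) : Fin 6 → ℤ) := by
      rw [Submodule.coe_sub, gen_coe, ← hT3, ← hs, vec6_eq]
      simp [pr]
      refine ⟨?_, ?_, ?_, ?_, ?_, ?_⟩ <;> ring
    rcases h3 (gen k) (t - gen k) (irr_gen k).1 ((c_pos_iff _).2 ⟨T', hT', hp⟩) (by abel) with h | h
    · exact gen_ne_zero k h
    · exact hne ⟨k, (sub_eq_zero.mp h).symm⟩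
  have key2 : ∀ k, ¬ IsBZ (T - lft (Pi.single k 1)) := fun k hk => key k ⟨_, hk, by abel⟩
  have h0 : T ≠ 0 := by
    rintro rfl
    apply h2
    apply Subtype.ext
    rw [← hT3]
    decide
  rw [nonneg9] at hT
  have e0 := key2 (.inl (false, 0))
  have e1 := key2 (.inl (false, 1))
  have e2 := key2 (.inl (false, 2))
  have e3 := key2 (.inl (true, 0))
  have e4 := key2 (.inl (true, 1))
  have e5 := key2 (.inl (true, 2))
  have e6 := key2 (.inr 0)
  have e7 := key2 (.inr 1)
  clear key key2 h1 h2 h3 hne hT3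
  simp only [IsBZ, nonneg9] at e0 e1 e2 e3 e4 e5 e6 e7
  simp [lft] at e0 e1 e2 e3 e4 e5 e6 e7
  rw [Ne, vec9_eq] at h0
  simp at h0
  have y0 : T 0 = 0 := by clear e1 e2 e3 e4 e5 e6 e7 h0; omega
  have y1 : T 1 = 0 := by clear e0 e2 e3 e4 e5 e6 e7 h0; omega
  have y2 : T 2 = 0 := by clear e0 e1 e3 e4 e5 e6 e7 h0; omega
  clear e0 e1 e2
  have y3 : T 3 = 0 ∨ T 6 = 0 := by clear e4 e5 e6 e7 h0; omega
  have y4 : T 4 = 0 ∨ T 7 = 0 := by clear e3 e5 e6 e7 h0; omega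
  have y5 : T 5 = 0 ∨ T 8 = 0 := by clear e3 e4 e6 e7 h0; omega
  clear e3 e4 e5
  have y6 : T 3 ≤ T 6 := by clear e7 h0; omega
  have y7 : T 6 ≤ T 3 := by clear e6 h0; omega
  omega

abbrev GG := Bool × (Bool → Equiv.Perm (Fin 3)) × Equiv.Perm (Fin 2)

def act (g : GG) : Equiv.Perm GI where
  toFun
    | .inl (b, i) => .inl (xor b g.1, g.2.1 b i)
    | .inr q => .inr (g.2.2 q)
  invFun
    | .inl (b, i) => .inl (xor b g.1, (g.2.1 (xor b g.1)).symm i)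
    | .inr q => .inr (g.2.2.symm q)
  left_inv := by rintro (⟨b, i⟩ | q) <;> simp
  right_inv := by rintro (⟨b, i⟩ | q) <;> simp

lemma act_inl (g : GG) (b : Bool) (i : Fin 3) :
    act g (.inl (b, i)) = .inl (xor b g.1, g.2.1 b i) := rfl

lemma act_inr (g : GG) (q : Fin 2) : act g (.inr q) = .inr (g.2.2 q) := rfl

lemma form_act (g : GG) (x : GI → ℤ) (p : ℤ → Prop) :
    (∀ i j q, p (form i j q (x ∘ act g))) ↔ ∀ i j q, p (form i j q x) := by
  obtain ⟨s, σ, ρ⟩ := g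
  cases s
  · have e : ∀ i j q, form i j q (x ∘ act (false, σ, ρ)) =
        form (σ false i) (σ true j) (ρ q) x := fun i j q => rfl
    simp only [e]
    constructor
    · intro h i j q
      simpa using h ((σ false).symm i) ((σ true).symm j) (ρ.symm q)
    · intro h i j q
      exact h _ _ _
  · have e : ∀ i j q, form i j q (x ∘ act (true, σ, ρ)) =
        form (σ true j) (σ false i) (ρ q) x := by
      intro i j q
      simp only [form, Function.comp, act_inl, act_inr]
      simp only [Bool.xor_true, Bool.not_false, Bool.not_true]
      ring
    simp only [e]
    constructor
    · intro h i j q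
      simpa using h ((σ false).symm j) ((σ true).symm i) (ρ.symm q)
    · intro h i j q
      exact h _ _ _

lemma form_act_symm (g : GG) (x : GI → ℤ) (p : ℤ → Prop) :
    (∀ i j q, p (form i j q (x ∘ (act g).symm))) ↔ ∀ i j q, p (form i j q x) := by
  rw [← form_act g (x ∘ (act g).symm)]
  have : (x ∘ (act g).symm) ∘ act g = x := by funext k; simp
  rw [this]

lemma mn_act_symm (g : GG) (x : GI → ℤ) : mn (x ∘ (act g).symm) = mn x := by
  apply eq_of_forall_le_iff
  intro k
  rw [le_mn, le_mn]
  exact form_act_symm g x (fun m => k ≤ m)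

def permE (g : GG) : (GI → ℤ) ≃ₗ[ℤ] (GI → ℤ) := LinearEquiv.funCongrLeft ℤ ℤ (act g).symm

lemma permE_apply (g : GG) (x : GI → ℤ) : permE g x = x ∘ (act g).symm := rfl

lemma map_ker (g : GG) :
    (LinearMap.ker phi).map (permE g : (GI → ℤ) →ₗ[ℤ] (GI → ℤ)) = LinearMap.ker phi := by
  ext y
  rw [Submodule.mem_map]
  constructor
  · rintro ⟨x, hx, rfl⟩
    rw [mem_ker_phi] at *
    exact (form_act_symm g x (fun m => m = 0)).2 hx
  · intro hy
    refine ⟨(permE g).symm y, ?_, by simp⟩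
    rw [mem_ker_phi] at *
    rw [← form_act_symm g _ (fun m => m = 0), ← permE_apply]
    simpa using hy

noncomputable def theta (g : GG) : latticeTM ≃ₗ[ℤ] latticeTM :=
  (phi.quotKerEquivOfSurjective phi_surj).symm ≪≫ₗ
    Submodule.Quotient.equiv (LinearMap.ker phi) (LinearMap.ker phi) (permE g) (map_ker g) ≪≫ₗ
    phi.quotKerEquivOfSurjective phi_surj

lemma theta_phi (g : GG) (x : GI → ℤ) : theta g (phi x) = phi (x ∘ (act g).symm) := by
  have : (phi.quotKerEquivOfSurjective phi_surj).symm (phi x) = Submodule.Quotient.mk x := by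
    rw [LinearEquiv.symm_apply_eq]; rfl
  unfold theta
  simp only [LinearEquiv.trans_apply, this]
  rfl

lemma theta_gen (g : GG) (k : GI) : theta g (gen k) = gen (act g k) := by
  unfold gen
  rw [theta_phi]
  congr 1
  funext l
  simp only [Function.comp, Pi.single_apply]
  congr 1
  rw [Equiv.symm_apply_eq]

lemma theta_c (g : GG) (t : latticeTM) : c (theta g t : latticeTM) = c t := by
  obtain ⟨x, rfl⟩ := phi_surj t
  rw [theta_phi, c_phi, c_phi, mn_act_symm]

lemma ext_gen (θ η : latticeTM ≃ₗ[ℤ] latticeTM) (h : ∀ k, θ (gen k) = η (gen k)) : θ = η := by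
  have : (θ : latticeTM →ₗ[ℤ] latticeTM) ∘ₗ phi = (η : latticeTM →ₗ[ℤ] latticeTM) ∘ₗ phi := by
    apply LinearMap.pi_ext'
    intro k
    apply LinearMap.ext_ring
    exact h k
  ext1 t
  obtain ⟨x, rfl⟩ := phi_surj t
  exact LinearMap.congr_fun this x

lemma theta_inj : Function.Injective theta := by
  intro g h e
  have hk : ∀ k, act g k = act h k := by
    intro k
    apply gen_injective
    rw [← theta_gen, ← theta_gen, e]
  obtain ⟨s, σ, ρ⟩ := g
  obtain ⟨s', σ', ρ'⟩ := h
  have h1 : ∀ b i, (xor b s, σ b i) = (xor b s', σ' b i) := fun b i => Sum.inl_injective (hk (.inl (b, i)))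
  have h2 : ∀ q, ρ q = ρ' q := fun q => Sum.inr_injective (hk (.inr q))
  have h3 : s = s' := by simpa using congrArg Prod.fst (h1 false 0)
  have h4 : σ = σ' := by
    funext b
    ext1 i
    exact congrArg Prod.snd (h1 b i)
  have h5 : ρ = ρ' := Equiv.ext h2
  subst h3 h4 h5
  rfl

lemma c_pair (k l : GI) : c ((gen k + gen l : latticeTM) : Fin 6 → ℤ) =
    (mn (Pi.single k 1 + Pi.single l 1) + 1).toNat := by
  rw [← c_phi, map_add]; rfl

lemma c_triple (k l m : GI) : c ((gen k + gen l + gen m : latticeTM) : Fin 6 → ℤ) =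
    (mn (Pi.single k 1 + Pi.single l 1 + Pi.single m 1) + 1).toNat := by
  rw [← c_phi, map_add, map_add]; rfl

lemma pair_table : ∀ k l : GI, (mn (Pi.single k 1 + Pi.single l 1) + 1).toNat = 2 →
    k.isRight ∧ l.isRight := by
  decide +kernel

lemma triple_table : ∀ p q r : Bool × Fin 3,
    (mn (Pi.single (.inl p) 1 + Pi.single (.inl q) 1 + Pi.single (.inl r) 1) + 1).toNat = 2 →
    p.1 = q.1 ∧ p.1 = r.1 := by
  decide +kernel

lemma theta_surj (θ : latticeTM ≃ₗ[ℤ] latticeTM)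
    (h : ∀ t : latticeTM, c ((θ t : Fin 6 → ℤ)) = c (t : Fin 6 → ℤ)) : ∃ g, theta g = θ := by
  choose f hf using fun k => gen_of_irr _ (irr_map θ h _ (irr_gen k))
  have finj : Function.Injective f := by
    intro k l e
    apply gen_injective
    apply θ.injective
    rw [← hf, ← hf, e]
  have hB := h (gen (.inr 0) + gen (.inr 1))
  rw [map_add, ← hf, ← hf, c_pair, c_pair] at hB
  have hB' := pair_table _ _ (hB.trans (by decide))
  have hr : ∀ q : Fin 2, ∃ r : Fin 2, f (.inr q) = .inr r := by
    intro q
    have : (f (.inr q)).isRight := by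
      fin_cases q
      · exact hB'.1
      · exact hB'.2
    exact Sum.isRight_iff.1 this
  choose ρ hρ using hr
  have ρinj : Function.Injective ρ := by
    intro a b e
    have : f (.inr a) = f (.inr b) := by rw [hρ, hρ, e]
    exact Sum.inr_injective (finj this)
  have ρbij : Function.Bijective ρ := Finite.injective_iff_bijective.1 ρinj
  have hl : ∀ p : Bool × Fin 3, ∃ r : Bool × Fin 3, f (.inl p) = .inl r := by
    intro p
    rcases hfp : f (.inl p) with r | q
    · exact ⟨r, rfl⟩
    · obtain ⟨a, rfl⟩ := ρbij.2 q
      rw [← hρ] at hfp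
      exact absurd (finj hfp) (by simp)
  choose β hβ using hl
  have βinj : Function.Injective β := by
    intro a b e
    have : f (.inl a) = f (.inl b) := by rw [hβ, hβ, e]
    exact Sum.inl_injective (finj this)
  have hs : ∀ b i, (β (b, i)).1 = (β (b, 0)).1 := by
    intro b i
    have hT := h (gen (.inl (b, 0)) + gen (.inl (b, 1)) + gen (.inl (b, 2)))
    rw [map_add, map_add, ← hf, ← hf, ← hf, hβ, hβ, hβ, c_triple, c_triple] at hT
    have := triple_table _ _ _ (hT.trans (by clear hT; revert b; decide))
    fin_cases i
    · rfl
    · exact this.1.symm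
    · exact this.2.symm
  have γinj : ∀ b, Function.Injective (fun i => (β (b, i)).2) := by
    intro b i j e
    have : β (b, i) = β (b, j) := Prod.ext (by rw [hs, hs b j]) e
    exact congrArg Prod.snd (βinj this)
  have γbij : ∀ b, Function.Bijective (fun i => (β (b, i)).2) := fun b =>
    Finite.injective_iff_bijective.1 (γinj b)
  have hne : (β (true, 0)).1 ≠ (β (false, 0)).1 := by
    intro e
    obtain ⟨i, hi⟩ := (γbij false).2 (β (true, 0)).2
    have : β (false, i) = β (true, 0) := Prod.ext (by rw [hs, e]) hi
    have := congrArg Prod.fst (βinj this)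
    simp at this
  refine ⟨((β (false, 0)).1, fun b => Equiv.ofBijective _ (γbij b), Equiv.ofBijective _ ρbij), ?_⟩
  apply ext_gen
  intro k
  rw [theta_gen, ← hf]
  congr 1
  rcases k with ⟨b, i⟩ | q
  · rw [act_inl, hβ]
    congr 1
    refine Prod.ext ?_ rfl
    show xor b (β (false, 0)).1 = (β (b, i)).1
    rw [hs b i]
    cases b
    · simp
    · revert hne
      generalize (β (true, 0)).1 = u
      generalize (β (false, 0)).1 = v
      revert u v
      decide
  · rw [act_inr, hρ]
    rfl

theorem stmt10 :
    Nat.card {θ : latticeTM ≃ₗ[ℤ] latticeTM //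
      ∀ t : latticeTM, c ((θ t : Fin 6 → ℤ)) = c (t : Fin 6 → ℤ)} = 144 := by
  have hb : Function.Bijective (fun g : GG => (⟨theta g, theta_c g⟩ :
      {θ : latticeTM ≃ₗ[ℤ] latticeTM //
        ∀ t : latticeTM, c ((θ t : Fin 6 → ℤ)) = c (t : Fin 6 → ℤ)})) := by
    constructor
    · intro g g' e
      exact theta_inj (congrArg Subtype.val e)
    · rintro ⟨θ, h⟩
      obtain ⟨g, hg⟩ := theta_surj θ h
      exact ⟨g, Subtype.ext hg⟩
  rw [← Nat.card_eq_of_bijective _ hb, Nat.card_eq_fintype_card]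
  simp [Fintype.card_perm, Nat.factorial]
end

section
/- Fix one vector a ∈ {r_{C₁}, r_{C₂}, r_{C₃}}, one vector b ∈ {r_{D₁}, r_{D₃}, r_{D₅}}, and one vector w ∈ {r_◁, r_▷}, and let t₁,…,t₅ be the five elements of R ∖ {a, b, w}. Then for every t ∈ Λ that is a linear combination with nonnegative real coefficients of t₁,…,t₅ and r_⋆ = (1,1,1,1,1,1), the SU(3) triple multiplicity satisfies 3·(c(t) − 1) = |det M(t₁,…,t₅,t)|, where M(t₁,…,t₅,t) is the 6×6 matrix whose columns are t₁,…,t₅,t. -/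
/-- membership in the lattice Λ : `ℓ₁+m₁+n₁ ≡ ℓ₂+m₂+n₂ (mod 3)`. -/
def inLattice (t : Fin 6 → ℤ) : Prop :=
  (t 0 + t 2 + t 4) ≡ (t 1 + t 3 + t 5) [ZMOD 3]

/-- The eight vectors of `R`, in coordinates `(ℓ₁,ℓ₂,m₁,m₂,n₁,n₂)`, in the order
`r_{C₁}, r_{C₂}, r_{C₃}, r_{D₁}, r_{D₃}, r_{D₅}, r_◁, r_▷`. -/
def Rvec : Fin 8 → Fin 6 → ℤ :=
  ![![0, 0, 0, 1, 1, 0],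
    ![1, 0, 0, 0, 0, 1],
    ![0, 1, 1, 0, 0, 0],
    ![1, 0, 0, 1, 0, 0],
    ![0, 0, 1, 0, 0, 1],
    ![0, 1, 0, 0, 1, 0],
    ![1, 0, 1, 0, 1, 0],
    ![0, 1, 0, 1, 0, 1]]

/-- The vectors of `R` as real vectors. -/
noncomputable def RvecR (k : Fin 8) : Fin 6 → ℝ := fun i => (Rvec k i : ℝ)

def toR (t : Fin 6 → ℤ) : Fin 6 → ℝ := fun i => (t i : ℝ)

theorem c_count (t : Fin 6 → ℤ) (k lo hi : ℤ)
    (hk : 3 * k = t 1 + t 3 + t 5 - (t 0 + t 2 + t 4))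
    (h : ∀ p : ℤ, (0 ≤ p ∧ t 3 - t 0 - k ≤ p ∧ t 4 + k - t 1 ≤ p ∧ p ≤ t 3 ∧ p ≤ t 4 ∧
      p ≤ t 3 - k ∧ p ≤ t 5 - k + t 3 - t 0 ∧ p ≤ t 4 + k ∧ p ≤ t 2 - t 1 + t 4 + k) ↔
      lo ≤ p ∧ p ≤ hi) (hle : lo ≤ hi) :
    (c t : ℤ) = hi - lo + 1 := by
  have key : ∀ T : Fin 9 → ℤ, IsBZ T ∧ pr T = t → (lo ≤ T 0 ∧ T 0 ≤ hi) ∧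
      T = ![T 0, T 0 + k - t 3 + t 0, T 0 + t 1 - t 4 - k, t 3 - T 0, t 4 - T 0,
        t 5 - (T 0 + k - t 3 + t 0), t 0 - (T 0 + k - t 3 + t 0),
        t 1 - (T 0 + t 1 - t 4 - k), t 2 - (T 0 + t 1 - t 4 - k)] := by
    rintro T ⟨⟨h1, h2, h3⟩, h4⟩
    have e0 := congrFun h4 0
    have e1 := congrFun h4 1
    have e2 := congrFun h4 2
    have e3 := congrFun h4 3
    have e4 := congrFun h4 4
    have e5 := congrFun h4 5
    simp [pr] at e0 e1 e2 e3 e4 e5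
    have p0 := h1 0
    have p1 := h1 1
    have p2 := h1 2
    have p3 := h1 3
    have p4 := h1 4
    have p5 := h1 5
    have p6 := h1 6
    have p7 := h1 7
    have p8 := h1 8
    refine ⟨(h _).1 (by omega), ?_⟩
    funext i
    fin_cases i <;> simp <;> omega
  have eqv : {T : Fin 9 → ℤ // IsBZ T ∧ pr T = t} ≃ Set.Icc lo hi :=
    { toFun := fun T => ⟨T.1 0, (key T.1 T.2).1⟩
      invFun := fun p => ⟨![p.1, p.1 + k - t 3 + t 0, p.1 + t 1 - t 4 - k, t 3 - p.1, t 4 - p.1,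
        t 5 - (p.1 + k - t 3 + t 0), t 0 - (p.1 + k - t 3 + t 0),
        t 1 - (p.1 + t 1 - t 4 - k), t 2 - (p.1 + t 1 - t 4 - k)], by
          have hp := (h p.1).2 p.2
          refine ⟨⟨?_, ?_, ?_⟩, ?_⟩
          · intro i
            fin_cases i <;> simp <;> omega
          · simp
            omega
          · simp
            omega
          · funext i
            fin_cases i <;> (simp [pr]; try omega)⟩
      left_inv := fun T => Subtype.ext (key T.1 T.2).2.symm
      right_inv := fun p => by simp }
  unfold c
  rw [Nat.card_congr eqv]
  simp
  omega

/-- The matrix of the statement. -/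
def MM (e : Fin 5 → Fin 8) (t : Fin 6 → ℤ) : Matrix (Fin 6) (Fin 6) ℤ :=
  Matrix.of fun r q : Fin 6 => if hq : (q : ℕ) < 5 then Rvec (e ⟨q, hq⟩) r else t r

/-- The cone condition of the statement. -/
def Cone (e : Fin 5 → Fin 8) (t : Fin 6 → ℤ) : Prop :=
  ∃ (a : Fin 5 → ℝ) (b : ℝ), (∀ m, 0 ≤ a m) ∧ 0 ≤ b ∧
      toR t = (∑ m, a m • RvecR (e m)) + b • (fun _ => (1 : ℝ))

theorem lo_hi (t : Fin 6 → ℤ) (k lo hi D : ℤ)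
    (hk : 3 * k = t 1 + t 3 + t 5 - (t 0 + t 2 + t 4))
    (hD : D = 3 * (hi - lo) ∨ D = -(3 * (hi - lo)))
    (hlo : lo = 0 ∨ lo = t 3 - t 0 - k ∨ lo = t 4 + k - t 1)
    (hhi : hi = t 3 ∨ hi = t 4 ∨ hi = t 3 - k ∨ hi = t 5 - k + t 3 - t 0 ∨ hi = t 4 + k ∨
      hi = t 2 - t 1 + t 4 + k)
    (h : 0 ≤ lo ∧ t 3 - t 0 - k ≤ lo ∧ t 4 + k - t 1 ≤ lo ∧ hi ≤ t 3 ∧ hi ≤ t 4 ∧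
      hi ≤ t 3 - k ∧ hi ≤ t 5 - k + t 3 - t 0 ∧ hi ≤ t 4 + k ∧ hi ≤ t 2 - t 1 + t 4 + k ∧
      lo ≤ hi) :
    3 * ((c t : ℤ) - 1) = |D| := by
  rw [c_count t k lo hi hk (fun p => by omega) (by omega)]
  rw [(abs_eq (by omega)).2 hD]
  ring

theorem ints (t : Fin 6 → ℤ) (k lo hi : ℤ)
    (h : (0 : ℝ) ≤ lo ∧ (t 3 - t 0 - k : ℝ) ≤ lo ∧ (t 4 + k - t 1 : ℝ) ≤ lo ∧ (hi : ℝ) ≤ t 3 ∧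
      (hi : ℝ) ≤ t 4 ∧
      (hi : ℝ) ≤ t 3 - k ∧ (hi : ℝ) ≤ t 5 - k + t 3 - t 0 ∧ (hi : ℝ) ≤ t 4 + k ∧
      (hi : ℝ) ≤ t 2 - t 1 + t 4 + k ∧ (lo : ℝ) ≤ hi) :
    0 ≤ lo ∧ t 3 - t 0 - k ≤ lo ∧ t 4 + k - t 1 ≤ lo ∧ hi ≤ t 3 ∧ hi ≤ t 4 ∧
      hi ≤ t 3 - k ∧ hi ≤ t 5 - k + t 3 - t 0 ∧ hi ≤ t 4 + k ∧ hi ≤ t 2 - t 1 + t 4 + k ∧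
      lo ≤ hi := by
  exact_mod_cast h

theorem MM_det (e : Fin 5 → Fin 8) (t : Fin 6 → ℤ) :
    (MM e t).det = ∑ i : Fin 6, t i * ((-1) ^ ((i : ℕ) + 5) *
      (Matrix.of fun r q : Fin 5 => Rvec (e q) (i.succAbove r)).det) := by
  rw [Matrix.det_succ_column _ (5 : Fin 6)]
  refine Finset.sum_congr rfl fun i _ => ?_
  have : (MM e t).submatrix i.succAbove (Fin.succAbove 5) =
      (Matrix.of fun r q : Fin 5 => Rvec (e q) (i.succAbove r)) := by
    ext r q
    have : (Fin.succAbove (5 : Fin 6) q) = q.castSucc := by revert q; decide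
    simp [MM, this]
  rw [this]
  have h5 : MM e t i 5 = t i := by simp [MM]
  rw [h5]
  simp only [show ((5 : Fin 6) : ℕ) = 5 from rfl]
  ring

/-- Canonical enumeration of the complement of `ia`, `ib`, `iw`. -/
def ee (ia ib iw : Fin 8) : Fin 5 → Fin 8 :=
  ![if ia = 0 then 1 else 0, if ia = 2 then 1 else 2, if ib = 3 then 4 else 3,
    if ib = 5 then 4 else 5, if iw = 6 then 7 else 6]

/-- Coefficients of three times (upper bound minus lower bound). -/
def cof (ia ib iw : Fin 8) : Fin 6 → ℤ :=
  (if iw = 6 then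
      (if ib = 3 then ![1, -1, 1, 2, 1, -1] else if ib = 4 then ![-1, -2, 2, 1, 2, 1]
        else ![0, 0, 0, 0, 3, 0])
     else (if ib = 3 then ![0, 0, 0, 3, 0, 0] else if ib = 4 then ![-2, -1, 1, 2, 1, 2]
        else ![-1, 1, -1, 1, 2, 1])) -
  (if ia = 0 then 0 else if ia = 1 then ![-2, -1, 1, 2, 1, -1] else ![-1, -2, -1, 1, 2, 1])

/-- Laplace expansion along the first row, as a computable function skipping zero entries. -/
def dt : (n : ℕ) → (Fin n → Fin n → ℤ) → ℤ
  | 0, _ => 1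
  | n + 1, M => ∑ i : Fin (n + 1), if M 0 i = 0 then 0 else
      (-1) ^ (i : ℕ) * M 0 i * dt n (fun r q => M r.succ (i.succAbove q))

theorem det_eq_dt (n : ℕ) (M : Fin n → Fin n → ℤ) : (Matrix.of M).det = dt n M := by
  induction n with
  | zero => simp [dt]
  | succ n ih =>
    rw [Matrix.det_succ_row_zero, dt]
    refine Finset.sum_congr rfl fun i _ => ?_
    rw [← ih]
    split_ifs with h
    · simp [h]
    · rfl

set_option maxHeartbeats 4000000 in
theorem minors (ia ib iw : Fin 8)
    (ha : ia = 0 ∨ ia = 1 ∨ ia = 2) (hb : ib = 3 ∨ ib = 4 ∨ ib = 5)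
    (hw : iw = 6 ∨ iw = 7) : ∃ s : ℤ, (s = 1 ∨ s = -1) ∧ ∀ i : Fin 6, ((-1) ^ ((i : ℕ) + 5) *
      (Matrix.of fun r q : Fin 5 => Rvec (ee ia ib iw q) (i.succAbove r)).det) =
        s * cof ia ib iw i := by
  have h : (∀ i : Fin 6, ((-1) ^ ((i : ℕ) + 5) *
      (Matrix.of fun r q : Fin 5 => Rvec (ee ia ib iw q) (i.succAbove r)).det) =
        1 * cof ia ib iw i) ∨ (∀ i : Fin 6, ((-1) ^ ((i : ℕ) + 5) *
      (Matrix.of fun r q : Fin 5 => Rvec (ee ia ib iw q) (i.succAbove r)).det) =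
        -1 * cof ia ib iw i) := by
    simp only [det_eq_dt]
    rcases ha with rfl | rfl | rfl <;> rcases hb with rfl | rfl | rfl <;>
      rcases hw with rfl | rfl <;> decide +kernel
  rcases h with h | h
  · exact ⟨1, Or.inl rfl, h⟩
  · exact ⟨-1, Or.inr rfl, h⟩

set_option maxHeartbeats 8000000 in
theorem canon (ia ib iw : Fin 8)
    (ha : ia = 0 ∨ ia = 1 ∨ ia = 2) (hb : ib = 3 ∨ ib = 4 ∨ ib = 5)
    (hw : iw = 6 ∨ iw = 7) :
    ∃ e : Fin 5 → Fin 8, (∀ k, k ≠ ia → k ≠ ib → k ≠ iw → ∃ m, e m = k) ∧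
      ∀ t, inLattice t → Cone e t → 3 * ((c t : ℤ) - 1) = |(MM e t).det| := by
  refine ⟨ee ia ib iw, ?_, ?_⟩
  · rcases ha with rfl | rfl | rfl <;> rcases hb with rfl | rfl | rfl <;>
      rcases hw with rfl | rfl <;> decide
  intro t hL hC
  obtain ⟨k, hk⟩ : ∃ k, 3 * k = t 1 + t 3 + t 5 - (t 0 + t 2 + t 4) := by
    obtain ⟨k, hk⟩ := hL.dvd
    exact ⟨k, hk.symm⟩
  have hkR : (3 * k : ℝ) = t 1 + t 3 + t 5 - (t 0 + t 2 + t 4) := by exact_mod_cast hk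
  obtain ⟨a, b, hpos, hb0, heq⟩ := hC
  have a0 := hpos 0
  have a1 := hpos 1
  have a2 := hpos 2
  have a3 := hpos 3
  have a4 := hpos 4
  have e0 := congrFun heq 0
  have e1 := congrFun heq 1
  have e2 := congrFun heq 2
  have e3 := congrFun heq 3
  have e4 := congrFun heq 4
  have e5 := congrFun heq 5
  clear hpos heq
  apply lo_hi t k (if ia = 0 then 0 else if ia = 1 then t 3 - t 0 - k else t 4 + k - t 1)
    (if iw = 6 then
      (if ib = 3 then t 3 - k else if ib = 4 then t 2 - t 1 + t 4 + k else t 4)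
     else (if ib = 3 then t 3 else if ib = 4 then t 5 - k + t 3 - t 0 else t 4 + k)) _ hk
  · rw [MM_det, Fin.sum_univ_six]
    obtain ⟨s, hs, hm⟩ := minors ia ib iw ha hb hw
    rw [hm 0, hm 1, hm 2, hm 3, hm 4, hm 5]
    clear e0 e1 e2 e3 e4 e5 hm
    rcases ha with rfl | rfl | rfl <;> rcases hb with rfl | rfl | rfl <;>
      rcases hw with rfl | rfl <;> rcases hs with rfl | rfl <;>
      simp [cof] <;> omega
  · split_ifs <;> simp
  · split_ifs <;> simp
  · apply ints
    simp only [Fin.sum_univ_five, toR, RvecR, Pi.add_apply, Pi.smul_apply, smul_eq_mul] at e0 e1 e2 e3 e4 e5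
    rcases ha with rfl | rfl | rfl <;> rcases hb with rfl | rfl | rfl <;>
      rcases hw with rfl | rfl <;>
      simp [Rvec, ee] at e0 e1 e2 e3 e4 e5 <;>
      simp only [Fin.reduceEq, reduceIte] <;>
      refine ⟨?_, ?_, ?_, ?_, ?_, ?_, ?_, ?_, ?_, ?_⟩ <;> push_cast <;> linarith

theorem stmt18 (ia ib iw : Fin 8)
    (ha : ia = 0 ∨ ia = 1 ∨ ia = 2) (hb : ib = 3 ∨ ib = 4 ∨ ib = 5)
    (hw : iw = 6 ∨ iw = 7)
    -- `e` enumerates the five elements of `R ∖ {a, b, w}`: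
    (e : Fin 5 → Fin 8) (he : Function.Injective e)
    (he' : ∀ m, e m ≠ ia ∧ e m ≠ ib ∧ e m ≠ iw)
    (t : Fin 6 → ℤ) (hΛ : inLattice t)
    -- `t` is a nonnegative real combination of `t₁,…,t₅` and `r⋆ = (1,1,1,1,1,1)`:
    (hcone : ∃ (a : Fin 5 → ℝ) (b : ℝ), (∀ m, 0 ≤ a m) ∧ 0 ≤ b ∧
      toR t = (∑ m, a m • RvecR (e m)) + b • (fun _ => (1 : ℝ))) :
    3 * ((c t : ℤ) - 1) =
      |(Matrix.of fun r q : Fin 6 =>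
          if hq : (q : ℕ) < 5 then Rvec (e ⟨q, hq⟩) r else t r).det| := by
  obtain ⟨e0, hs, hmain⟩ := canon ia ib iw ha hb hw
  have hex : ∀ m, ∃ m', e0 m' = e m := fun m => hs _ (he' m).1 (he' m).2.1 (he' m).2.2
  choose σ hσ using hex
  have hinj : Function.Injective σ := fun x y hxy => he (by rw [← hσ x, ← hσ y, hxy])
  have hbij : Function.Bijective σ := Finite.injective_iff_bijective.1 hinj
  let s : Equiv.Perm (Fin 5) := Equiv.ofBijective σ hbij
  have hes : ∀ m, e0 (s m) = e m := hσ
  have hC : Cone e0 t := by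
    obtain ⟨a, b, h1, h2, h3⟩ := hcone
    refine ⟨fun m => a (s.symm m), b, fun m => h1 _, h2, ?_⟩
    rw [h3]
    congr 1
    rw [← Equiv.sum_comp s (fun x => a (s.symm x) • RvecR (e0 x))]
    simp [hes]
  rw [hmain t hΛ hC]
  change _ = |(MM e t).det|
  have hdet : |(MM e t).det| = |(MM e0 t).det| := by
    let g : Fin 6 → Fin 6 := Fin.lastCases (Fin.last 5) (fun q => (s q).castSucc)
    have gl : g (Fin.last 5) = Fin.last 5 := Fin.lastCases_last
    have gc : ∀ q : Fin 5, g q.castSucc = (s q).castSucc := fun q => Fin.lastCases_castSucc q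
    have hg : Function.Injective g := by
      intro x y
      induction x using Fin.lastCases with
      | last =>
        induction y using Fin.lastCases with
        | last => exact fun _ => rfl
        | cast j =>
          rw [gl, gc]
          exact fun h => absurd h.symm (Fin.castSucc_lt_last _).ne
      | cast i =>
        induction y using Fin.lastCases with
        | last =>
          rw [gl, gc]
          exact fun h => absurd h (Fin.castSucc_lt_last _).ne
        | cast j =>
          rw [gc, gc]
          simp
    let G : Equiv.Perm (Fin 6) := Equiv.ofBijective g (Finite.injective_iff_bijective.1 hg)
    rw [← Matrix.abs_det_submatrix_equiv_equiv (Equiv.refl _) G (MM e0 t)]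
    congr 2
    ext r q
    change _ = MM e0 t r (g q)
    induction q using Fin.lastCases with
    | last =>
      rw [gl]
      simp [MM]
    | cast i =>
      rw [gc]
      simp [MM, hes]
  rw [hdet]
end

section
/- (Stability) Let u ∈ Λ with c(u) = 1 and let t ∈ Λ with c(t) ≠ 0. Then there exists a positive integer k₀ such that for all integers k ≥ k₀, c(t + k·u) = 1 + min{ f_i(t) − g_j(t) : i ∈ {1,2,3}, j ∈ {1,…,6}, f_i(u) = min_{p} f_p(u) and g_j(u) = max_{q} g_q(u) }; in particular the sequence k ↦ c(t + k·u) is eventually constant. -/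
noncomputable def ω (t : Fin 6 → ℝ) : ℝ := (t 0 + t 2 + t 4 - t 1 - t 3 - t 5) / 3

/-- the linear forms `f₁, f₂, f₃`. -/
noncomputable def f : Fin 3 → (Fin 6 → ℝ) → ℝ :=
  ![fun _ => 0, fun t => t 0 - t 3 - ω t, fun t => t 1 - t 4 + ω t]

/-- the linear forms `g₁, …, g₆`. -/
noncomputable def g : Fin 6 → (Fin 6 → ℝ) → ℝ :=
  ![fun t => -t 3, fun t => -t 4, fun t => t 0 - t 3 - t 5 - ω t,
    fun t => -t 3 - ω t, fun t => -t 4 + ω t, fun t => t 1 - t 2 - t 4 + ω t]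

/-- integral version of the forms `f`, with `w` the value of `ω`. -/
def fI (t : Fin 6 → ℤ) (w : ℤ) : Fin 3 → ℤ := ![0, t 0 - t 3 - w, t 1 - t 4 + w]

/-- integral version of the forms `g`, with `w` the value of `ω`. -/
def gI (t : Fin 6 → ℤ) (w : ℤ) : Fin 6 → ℤ :=
  ![-t 3, -t 4, t 0 - t 3 - t 5 - w, -t 3 - w, -t 4 + w, t 1 - t 2 - t 4 + w]

theorem omega_toR (t : Fin 6 → ℤ) (w : ℤ)
    (hw : 3 * w = t 0 + t 2 + t 4 - t 1 - t 3 - t 5) : ω (toR t) = w := by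
  have : (3 * w : ℝ) = t 0 + t 2 + t 4 - t 1 - t 3 - t 5 := by exact_mod_cast hw
  simp only [ω, toR]
  linarith

theorem f_toR (t : Fin 6 → ℤ) (w : ℤ)
    (hw : 3 * w = t 0 + t 2 + t 4 - t 1 - t 3 - t 5) (i : Fin 3) :
    f i (toR t) = fI t w i := by
  have h := omega_toR t w hw
  fin_cases i <;> simp [f, fI, h] <;> simp [toR]

theorem g_toR (t : Fin 6 → ℤ) (w : ℤ)
    (hw : 3 * w = t 0 + t 2 + t 4 - t 1 - t 3 - t 5) (i : Fin 6) :
    g i (toR t) = gI t w i := by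
  have h := omega_toR t w hw
  fin_cases i <;> simp [g, gI, h] <;> simp [toR]

/-- The fibre over `t` is parametrised by `x = -y₁`. -/
theorem c_eq_card (t : Fin 6 → ℤ) (w : ℤ)
    (hw : 3 * w = t 0 + t 2 + t 4 - t 1 - t 3 - t 5) :
    c t = Nat.card {x : ℤ // (∀ i, x ≤ fI t w i) ∧ ∀ j, gI t w j ≤ x} := by
  unfold c
  refine Nat.card_congr
    { toFun := fun T => ⟨-(T.1 0), ?_⟩
      invFun := fun x => ⟨![-x.1, t 0 - t 3 - w - x.1, t 1 - t 4 + w - x.1, t 3 + x.1, t 4 + x.1,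
        t 5 - t 0 + t 3 + w + x.1, t 3 + w + x.1, t 4 - w + x.1,
        t 2 - t 1 + t 4 - w + x.1], ?_⟩
      left_inv := ?_
      right_inv := ?_ }
  · obtain ⟨T, ⟨hn, h1, h2⟩, rfl⟩ := T
    have a0 := hn 0
    have a1 := hn 1
    have a2 := hn 2
    have a3 := hn 3
    have a4 := hn 4
    have a5 := hn 5
    have a6 := hn 6
    have a7 := hn 7
    have a8 := hn 8
    simp [pr] at hw
    constructor
    · intro i
      fin_cases i <;> simp [fI, pr] <;> omega
    · intro i
      fin_cases i <;> simp [gI, pr] <;> omega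
  · obtain ⟨x, h1, h2⟩ := x
    simp only [Fin.forall_fin_succ, fI, gI] at h1 h2
    simp at h1 h2
    refine ⟨⟨?_, ?_, ?_⟩, ?_⟩
    · intro i
      fin_cases i <;> simp <;> omega
    · simp <;> omega
    · simp <;> omega
    · funext i
      fin_cases i <;> simp [pr]
  · rintro ⟨T, ⟨hn, h1, h2⟩, rfl⟩
    simp [pr] at hw
    apply Subtype.ext
    funext i
    fin_cases i <;> simp [pr] <;> omega
  · rintro ⟨x, h1, h2⟩
    simp

theorem card_interval (A : Fin 3 → ℤ) (B : Fin 6 → ℤ) (i₀ : Fin 3) (j₀ : Fin 6)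
    (hA : ∀ i, A i₀ ≤ A i) (hB : ∀ j, B j ≤ B j₀) :
    Nat.card {x : ℤ // (∀ i, x ≤ A i) ∧ ∀ j, B j ≤ x} = (A i₀ + 1 - B j₀).toNat := by
  have h : Nat.card (Set.Icc (B j₀) (A i₀)) = (A i₀ + 1 - B j₀).toNat := by
    simp
  rw [← h]
  refine Nat.card_congr (Equiv.subtypeEquivRight fun x => ?_)
  rw [Set.mem_Icc]
  exact ⟨fun h => ⟨h.2 _, h.1 _⟩, fun h => ⟨fun i => h.2.trans (hA i), fun j => (hB j).trans h.1⟩⟩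

/-- lexicographic minimisers eventually minimise `a + k b`. -/
theorem exists_lexmin {n : ℕ} (a b : Fin (n + 1) → ℤ) :
    ∃ i₀, (∀ i, b i₀ ≤ b i) ∧ (∀ i, b i = b i₀ → a i₀ ≤ a i) ∧
      ∃ K : ℕ, ∀ k : ℕ, K ≤ k → ∀ i, a i₀ + k * b i₀ ≤ a i + k * b i := by
  obtain ⟨i₀, h⟩ := Finite.exists_min (fun i => toLex (b i, a i))
  simp only [Prod.Lex.toLex_le_toLex] at h
  refine ⟨i₀, fun i => ?_, fun i hi => ?_, ∑ i, (a i₀ - a i).toNat, fun k hk i => ?_⟩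
  · rcases h i with h | h <;> omega
  · rcases h i with h | h <;> omega
  · have h1 : (a i₀ - a i).toNat ≤ ∑ i, (a i₀ - a i).toNat :=
      Finset.single_le_sum (f := fun i => (a i₀ - a i).toNat) (fun _ _ => Nat.zero_le _)
        (Finset.mem_univ i)
    have h2 : a i₀ - a i ≤ k := by omega
    rcases h i with h | h
    · have : b i₀ + 1 ≤ b i := h
      nlinarith
    · have := h.1
      rw [this]
      linarith [h.2]

theorem exists_omega (t : Fin 6 → ℤ) (h : inLattice t) :
    ∃ w : ℤ, 3 * w = t 0 + t 2 + t 4 - t 1 - t 3 - t 5 := by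
  obtain ⟨w, hw⟩ := h.symm.dvd
  exact ⟨w, by omega⟩

theorem stmt19 (u t : Fin 6 → ℤ) (hu : inLattice u) (ht : inLattice t)
    (hcu : c u = 1) (hct : c t ≠ 0) :
    ∃ k₀ : ℕ, 0 < k₀ ∧ ∀ k : ℕ, k₀ ≤ k →
      (c (t + (k : ℤ) • u) : ℝ) = 1 + sInf {x : ℝ |
        ∃ (i : Fin 3) (j : Fin 6),
          f i (toR u) = (⨅ p : Fin 3, f p (toR u)) ∧
          g j (toR u) = (⨆ q : Fin 6, g q (toR u)) ∧
          x = f i (toR t) - g j (toR t)} := by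
  obtain ⟨v, hv⟩ := exists_omega u hu
  obtain ⟨w, hw⟩ := exists_omega t ht
  obtain ⟨i₀, hi1, hi2, K1, hK1⟩ := exists_lexmin (fI t w) (fI u v)
  obtain ⟨j₀, hj1, hj2, K2, hK2⟩ := exists_lexmin (fun j => -gI t w j) (fun j => -gI u v j)
  simp only [neg_le_neg_iff, neg_inj] at hj1 hj2
  rw [c_eq_card u v hv, card_interval _ _ i₀ j₀ hi1 hj1] at hcu
  have huv : fI u v i₀ = gI u v j₀ := by omega
  rw [c_eq_card t w hw] at hct
  obtain ⟨⟨x, hx1, hx2⟩⟩ := (Nat.card_ne_zero.1 hct).1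
  have hpos : gI t w j₀ ≤ fI t w i₀ := (hx2 _).trans (hx1 _)
  have hinf : (⨅ p : Fin 3, f p (toR u)) = fI u v i₀ := by
    refine IsLeast.csInf_eq ⟨⟨i₀, f_toR u v hv i₀⟩, ?_⟩
    rintro _ ⟨i, rfl⟩
    simp only [f_toR u v hv]
    exact_mod_cast hi1 i
  have hsup : (⨆ q : Fin 6, g q (toR u)) = gI u v j₀ := by
    refine IsGreatest.csSup_eq ⟨⟨j₀, g_toR u v hv j₀⟩, ?_⟩
    rintro _ ⟨i, rfl⟩
    simp only [g_toR u v hv]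
    exact_mod_cast hj1 i
  refine ⟨K1 + K2 + 1, by omega, fun k hk => ?_⟩
  have hS : sInf {x : ℝ |
        ∃ (i : Fin 3) (j : Fin 6),
          f i (toR u) = (⨅ p : Fin 3, f p (toR u)) ∧
          g j (toR u) = (⨆ q : Fin 6, g q (toR u)) ∧
          x = f i (toR t) - g j (toR t)} = ((fI t w i₀ - gI t w j₀ : ℤ) : ℝ) := by
    rw [hinf, hsup]
    simp only [f_toR u v hv, g_toR u v hv, f_toR t w hw, g_toR t w hw, Int.cast_inj]
    refine IsLeast.csInf_eq ⟨⟨i₀, j₀, rfl, rfl, by push_cast; rfl⟩, ?_⟩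
    rintro _ ⟨i, j, h1, h2, rfl⟩
    have := hi2 i h1
    have := hj2 j h2
    have : fI t w i₀ - gI t w j₀ ≤ fI t w i - gI t w j := by omega
    exact_mod_cast this
  rw [hS]
  have hfk : ∀ i, fI (t + (k : ℤ) • u) (w + k * v) i = fI t w i + k * fI u v i := by
    intro i
    fin_cases i <;> simp [fI] <;> ring
  have hgk : ∀ i, gI (t + (k : ℤ) • u) (w + k * v) i = gI t w i + k * gI u v i := by
    intro i
    fin_cases i <;> simp [gI] <;> ring
  rw [c_eq_card (t + (k : ℤ) • u) (w + k * v)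
      (by simp only [Pi.add_apply, Pi.smul_apply, smul_eq_mul]; linear_combination hw + k * hv),
    card_interval _ _ i₀ j₀ (fun i => by rw [hfk, hfk]; exact hK1 k (by omega) i)
      (fun j => by rw [hgk, hgk]; have := hK2 k (by omega) j; linarith),
    hfk, hgk, huv]
  have e : ((fI t w i₀ + k * gI u v j₀ + 1 - (gI t w j₀ + k * gI u v j₀)).toNat : ℤ)
      = 1 + (fI t w i₀ - gI t w j₀) := by
    rw [Int.toNat_of_nonneg (by linarith)]; ring
  exact_mod_cast e
end
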